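/- arXiv:2001.06176 — 2 statements merged into one kernel-verified Lean document; each statement's English description precedes it below -/
import Mathlib

section
/- Let a > 1 and ρ > 0. For all x, x' ∈ ℝ^p one has Σ_{i=1}^p ψ*_a(ρ|x_i|) ≥ Σ_{i=1}^p ψ*_a(ρ|x'_i|) + ρ Σ_{i=1}^p w_ρ(x')_i (|x_i| − |x'_i|). Consequently, for f : ℝⁿ → ℝ, A ∈ ℝ^{n×p}, b ∈ ℝⁿ, μ > 0, λ > 0, the function x ↦ f(Ax−b) + (μ/2)‖x‖² + λ Σ_{i=1}^p (1 − w_ρ(x')_i)|x_i| + λ Σ_{i=1}^p w_ρ(x')_i |x'_i| − λρ⁻¹ Σ_{i=1}^p ψ*_a(ρ|x'_i|) majorizes Θ_{λ,ρ}(x) := f(Ax−b) + (μ/2)‖x‖² + λ‖x‖₁ − λρ⁻¹ Σ_{i=1}^p ψ*_a(ρ|x_i|) on ℝ^p, with equality at x = x'. -/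
open scoped BigOperators

/-- The piecewise function ψ*_a. -/
noncomputable def psiStar (a s : ℝ) : ℝ :=
  if s ≤ 2 / (a + 1) then 0
  else if s ≤ 2 * a / (a + 1) then ((a + 1) * s - 2) ^ 2 / (4 * (a ^ 2 - 1))
  else s - 1

/-- w_ρ(x)ᵢ = min(1, max(0, ((a+1)ρ|xᵢ| − 2)/(2(a−1)))). -/
noncomputable def wRho {p : ℕ} (a ρ : ℝ) (x : Fin p → ℝ) : Fin p → ℝ :=
  fun i => min 1 (max 0 (((a + 1) * ρ * |x i| - 2) / (2 * (a - 1))))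

/-- The DC surrogate objective Θ_{λ,ρ}. -/
noncomputable def Theta {n p : ℕ} (f : (Fin n → ℝ) → ℝ) (A : Matrix (Fin n) (Fin p) ℝ)
    (b : Fin n → ℝ) (μ lam a ρ : ℝ) (x : Fin p → ℝ) : ℝ :=
  f (A.mulVec x - b) + μ / 2 * (∑ i, (x i) ^ 2) + lam * (∑ i, |x i|) -
    lam * ρ⁻¹ * ∑ i, psiStar a (ρ * |x i|)

/-- The majorization Ξ_{λ,ρ}(·, x') of Θ_{λ,ρ} at x'. -/
noncomputable def Xi {n p : ℕ} (f : (Fin n → ℝ) → ℝ) (A : Matrix (Fin n) (Fin p) ℝ)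
    (b : Fin n → ℝ) (μ lam a ρ : ℝ) (x' x : Fin p → ℝ) : ℝ :=
  f (A.mulVec x - b) + μ / 2 * (∑ i, (x i) ^ 2) +
    lam * (∑ i, (1 - wRho a ρ x' i) * |x i|) +
    lam * (∑ i, wRho a ρ x' i * |x' i|) - lam * ρ⁻¹ * ∑ i, psiStar a (ρ * |x' i|)

/-- In terms of `k = (a - 1) / (a + 1)`, the middle piece of `psiStar a` lives on `[1 - k, 1 + k]`. -/
lemma psiStar_eq {a : ℝ} (ha : 1 < a) (s : ℝ) :
    psiStar a s = if s ≤ 1 - (a - 1) / (a + 1) then 0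
      else if s ≤ 1 + (a - 1) / (a + 1) then
        (s - 1 + (a - 1) / (a + 1)) ^ 2 / (4 * ((a - 1) / (a + 1)))
      else s - 1 := by
  have h1 : a + 1 ≠ 0 := by linarith
  have h2 : a - 1 ≠ 0 := by linarith
  have h3 : a ^ 2 - 1 ≠ 0 := by nlinarith
  have e1 : 2 / (a + 1) = 1 - (a - 1) / (a + 1) := by field_simp; ring
  have e2 : 2 * a / (a + 1) = 1 + (a - 1) / (a + 1) := by field_simp; ring
  have e3 : ((a + 1) * s - 2) ^ 2 / (4 * (a ^ 2 - 1)) =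
      (s - 1 + (a - 1) / (a + 1)) ^ 2 / (4 * ((a - 1) / (a + 1))) := by
    have e4 : a ^ 2 - 1 = (a - 1) * (a + 1) := by ring
    rw [e4]
    field_simp
    ring
  rw [psiStar, e1, e2, e3]

/-- The Fenchel–Young inequality: `psiStar a` dominates its affine minorants with slopes in
`[0, 1]`. -/
lemma le_psiStar {a : ℝ} (ha : 1 < a) (s : ℝ) {w : ℝ} (hw0 : 0 ≤ w) (hw1 : w ≤ 1) :
    w * s - ((a - 1) / (a + 1) * w ^ 2 + (1 - (a - 1) / (a + 1)) * w) ≤ psiStar a s := by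
  rw [psiStar_eq ha]
  have hk : 0 < (a - 1) / (a + 1) := div_pos (by linarith) (by linarith)
  generalize (a - 1) / (a + 1) = k at hk ⊢
  split_ifs with h1 h2
  · nlinarith [mul_nonneg hw0 (sub_nonneg.2 h1), mul_nonneg hk.le (sq_nonneg w)]
  · rw [le_div_iff₀ (by positivity)]
    nlinarith [sq_nonneg (s - 1 + k - 2 * k * w)]
  · push Not at h2
    nlinarith [mul_nonneg (sub_nonneg.2 hw1) (sub_nonneg.2 h2.le),
      mul_nonneg hk.le (sq_nonneg (1 - w))]

/-- The Fenchel–Young inequality is an equality at the clipped slope. -/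
lemma psiStar_eq_of_clip {a : ℝ} (ha : 1 < a) (s : ℝ) {w : ℝ}
    (hw : w = min 1 (max 0 (((a + 1) * s - 2) / (2 * (a - 1))))) :
    psiStar a s = w * s - ((a - 1) / (a + 1) * w ^ 2 + (1 - (a - 1) / (a + 1)) * w) := by
  have hk : 0 < (a - 1) / (a + 1) := div_pos (by linarith) (by linarith)
  have ht : ((a + 1) * s - 2) / (2 * (a - 1)) =
      (s - 1 + (a - 1) / (a + 1)) / (2 * ((a - 1) / (a + 1))) := by
    have h1 : a + 1 ≠ 0 := by linarith
    have h2 : a - 1 ≠ 0 := by linarith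
    field_simp
    ring
  rw [ht] at hw
  rw [psiStar_eq ha]
  generalize (a - 1) / (a + 1) = k at hk hw ⊢
  split_ifs with h1 h2
  · rw [max_eq_left (div_nonpos_of_nonpos_of_nonneg (by linarith) (by positivity)),
      min_eq_right zero_le_one] at hw
    simp [hw]
  · push Not at h1
    rw [max_eq_right (div_nonneg (by linarith) (by positivity)),
      min_eq_right ((div_le_one (by positivity)).2 (by linarith))] at hw
    rw [hw]
    field_simp
    ring
  · push Not at h2
    have h3 : 1 ≤ (s - 1 + k) / (2 * k) := (one_le_div (by positivity)).2 (by linarith)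
    rw [min_eq_left (h3.trans (le_max_right _ _))] at hw
    rw [hw]
    ring

/-- The clipped slope is a subgradient of `psiStar a`. -/
lemma psiStar_add_wRho_mul_le {p : ℕ} {a : ℝ} (ha : 1 < a) (ρ : ℝ) (x x' : Fin p → ℝ)
    (i : Fin p) :
    psiStar a (ρ * |x' i|) + ρ * (wRho a ρ x' i * (|x i| - |x' i|)) ≤
      psiStar a (ρ * |x i|) := by
  have hle := le_psiStar ha (ρ * |x i|) (w := wRho a ρ x' i)
    (le_min zero_le_one (le_max_left _ _)) (min_le_left _ _)
  have heq := psiStar_eq_of_clip ha (ρ * |x' i|) (w := wRho a ρ x' i)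
    (by rw [wRho, mul_assoc])
  linarith

/-- The gap between the majorization and the objective is the gap in the subgradient inequality
for `psiStar a`. -/
lemma Xi_sub_Theta {n p : ℕ} (f : (Fin n → ℝ) → ℝ) (A : Matrix (Fin n) (Fin p) ℝ)
    (b : Fin n → ℝ) (μ lam a : ℝ) {ρ : ℝ} (hρ : ρ ≠ 0) (x' x : Fin p → ℝ) :
    Xi f A b μ lam a ρ x' x - Theta f A b μ lam a ρ x =
      lam * ρ⁻¹ * (∑ i, psiStar a (ρ * |x i|) - (∑ i, psiStar a (ρ * |x' i|) +
        ρ * ∑ i, wRho a ρ x' i * (|x i| - |x' i|))) := by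
  simp only [Xi, Theta, sub_mul, mul_sub, one_mul, Finset.sum_sub_distrib]
  field_simp
  ring

/-- the convexity inequality for ψ*_a and the resulting majorization of
Θ_{λ,ρ} which is exact at x'. -/
theorem stmt9 {n p : ℕ} (a ρ : ℝ) (ha : 1 < a) (hρ : 0 < ρ) :
    (∀ x x' : Fin p → ℝ,
      (∑ i, psiStar a (ρ * |x' i|)) + ρ * ∑ i, wRho a ρ x' i * (|x i| - |x' i|) ≤
        ∑ i, psiStar a (ρ * |x i|)) ∧
    (∀ (f : (Fin n → ℝ) → ℝ) (A : Matrix (Fin n) (Fin p) ℝ) (b : Fin n → ℝ)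
        (μ lam : ℝ), 0 < μ → 0 < lam →
      ∀ x' : Fin p → ℝ,
        (∀ x : Fin p → ℝ, Theta f A b μ lam a ρ x ≤ Xi f A b μ lam a ρ x' x) ∧
        Xi f A b μ lam a ρ x' x' = Theta f A b μ lam a ρ x') := by
  have hsub (x x' : Fin p → ℝ) :
      (∑ i, psiStar a (ρ * |x' i|)) + ρ * ∑ i, wRho a ρ x' i * (|x i| - |x' i|) ≤
        ∑ i, psiStar a (ρ * |x i|) := by
    rw [Finset.mul_sum, ← Finset.sum_add_distrib]
    exact Finset.sum_le_sum fun i _ => psiStar_add_wRho_mul_le ha ρ x x' i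
  refine ⟨hsub, fun f A b μ lam _ hlam x' => ⟨fun x => ?_, ?_⟩⟩
  · rw [← sub_nonneg, Xi_sub_Theta f A b μ lam a hρ.ne']
    exact mul_nonneg (by positivity) (sub_nonneg.2 (hsub x x'))
  · rw [← sub_eq_zero, Xi_sub_Theta f A b μ lam a hρ.ne']
    simp
end

section
/- Let a > 1, ρ > 0, λ > 0, μ > 0, γ₁ > 0, γ₂ > 0, f : ℝⁿ → ℝ convex, Ω ⊆ ℝ^p nonempty closed convex, A ∈ ℝ^{n×p}, b ∈ ℝⁿ. Define Θ_{λ,ρ}(x) = f(Ax−b) + (μ/2)‖x‖² + λ‖x‖₁ − λρ⁻¹ Σ_{i=1}^p ψ*_a(ρ|x_i|). Let x^k ∈ Ω and let x^{k+1} be a minimizer over Ω of x ↦ f(Ax−b) + (μ/2)‖x‖² + λ Σ_{i=1}^p (1 − w_ρ(x^k)_i)|x_i| + (γ₁/2)‖x − x^k‖² + (γ₂/2)‖A(x − x^k)‖². Then Θ_{λ,ρ}(x^k) ≥ Θ_{λ,ρ}(x^{k+1}) + γ₁‖x^{k+1} − x^k‖² + γ₂‖A(x^{k+1} − x^k)‖².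 -/
open scoped BigOperators

/-- Clamping to `[0, 1]` maximizes `m ↦ 2 m v - m ^ 2` over `[0, 1]`. -/
theorem two_mul_sub_sq_le_clamp (m v : ℝ) (h0 : 0 ≤ m) (h1 : m ≤ 1) :
    2 * m * v - m ^ 2 ≤ 2 * min 1 (max 0 v) * v - (min 1 (max 0 v)) ^ 2 := by
  rcases le_total v 0 with hv | hv
  · rw [max_eq_left hv, min_eq_right zero_le_one]
    nlinarith
  · rw [max_eq_right hv]
    rcases le_total v 1 with hv1 | hv1
    · rw [min_eq_right hv1]
      nlinarith [sq_nonneg (m - v)]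
    · rw [min_eq_left hv1]
      nlinarith

theorem psiStar_eq_clamp {a : ℝ} (ha : 1 < a) (s : ℝ) :
    psiStar a s = (a - 1) / (a + 1) *
      (2 * min 1 (max 0 (((a + 1) * s - 2) / (2 * (a - 1)))) *
          (((a + 1) * s - 2) / (2 * (a - 1))) -
        (min 1 (max 0 (((a + 1) * s - 2) / (2 * (a - 1))))) ^ 2) := by
  have h1 : 0 < a - 1 := by linarith
  have h2 : 0 < a + 1 := by linarith
  have h3 : a ^ 2 - 1 = (a - 1) * (a + 1) := by ring
  unfold psiStar
  split_ifs with hs hs'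
  · rw [le_div_iff₀ h2] at hs
    have hu : ((a + 1) * s - 2) / (2 * (a - 1)) ≤ 0 :=
      div_nonpos_of_nonpos_of_nonneg (by linarith) (by linarith)
    rw [max_eq_left hu, min_eq_right zero_le_one]
    ring
  · rw [le_div_iff₀ h2] at hs hs'
    have hu : 0 ≤ ((a + 1) * s - 2) / (2 * (a - 1)) :=
      div_nonneg (by linarith) (by linarith)
    have hu' : ((a + 1) * s - 2) / (2 * (a - 1)) ≤ 1 := by
      rw [div_le_one (by linarith)]
      linarith
    rw [max_eq_right hu, min_eq_right hu', h3]
    field_simp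
    ring
  · rw [le_div_iff₀ h2] at hs hs'
    have hu : 1 ≤ ((a + 1) * s - 2) / (2 * (a - 1)) := by
      rw [one_le_div (by linarith)]
      linarith
    rw [max_eq_right (zero_le_one.trans hu), min_eq_left hu]
    field_simp
    ring

/-- The clamped slope is a subgradient of `psiStar a` at `s`. -/
theorem psiStar_add_slope_mul_sub_le {a : ℝ} (ha : 1 < a) (s t : ℝ) :
    psiStar a s + min 1 (max 0 (((a + 1) * s - 2) / (2 * (a - 1)))) * (t - s) ≤
      psiStar a t := by
  have h1 : 0 < a - 1 := by linarith
  have h2 : 0 < a + 1 := by linarith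
  rw [psiStar_eq_clamp ha s, psiStar_eq_clamp ha t]
  set m := min 1 (max 0 (((a + 1) * s - 2) / (2 * (a - 1))))
  have hm0 : 0 ≤ m := le_min zero_le_one (le_max_left _ _)
  have hm1 : m ≤ 1 := min_le_left _ _
  refine le_of_eq_of_le ?_ (mul_le_mul_of_nonneg_left
    (two_mul_sub_sq_le_clamp m (((a + 1) * t - 2) / (2 * (a - 1))) hm0 hm1)
    (div_nonneg h1.le h2.le))
  field_simp
  ring

theorem wRho_le_one {p : ℕ} (a ρ : ℝ) (x : Fin p → ℝ) (i : Fin p) : wRho a ρ x i ≤ 1 :=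
  min_le_left _ _

theorem wRho_mul_sub_le {p : ℕ} {a ρ : ℝ} (ha : 1 < a) (hρ : 0 < ρ) (x y : Fin p → ℝ)
    (i : Fin p) :
    wRho a ρ x i * (|y i| - |x i|) ≤
      ρ⁻¹ * psiStar a (ρ * |y i|) - ρ⁻¹ * psiStar a (ρ * |x i|) := by
  have h := psiStar_add_slope_mul_sub_le ha (ρ * |x i|) (ρ * |y i|)
  rw [← mul_assoc (a + 1) ρ |x i|] at h
  change psiStar a (ρ * |x i|) + wRho a ρ x i * (ρ * |y i| - ρ * |x i|) ≤ _ at h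
  have h' := mul_le_mul_of_nonneg_left h (inv_nonneg.2 hρ.le)
  have e : ρ⁻¹ * (psiStar a (ρ * |x i|) + wRho a ρ x i * (ρ * |y i| - ρ * |x i|)) =
      ρ⁻¹ * psiStar a (ρ * |x i|) + wRho a ρ x i * (|y i| - |x i|) := by
    field_simp
  rw [e] at h'
  linarith

/-- The convex part of the surrogate problem is convex. -/
theorem convexOn_weighted_objective {n p : ℕ} {f : (Fin n → ℝ) → ℝ}
    (hf : ConvexOn ℝ Set.univ f) (A : Matrix (Fin n) (Fin p) ℝ) (b : Fin n → ℝ)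
    {μ lam : ℝ} (hμ : 0 ≤ μ) (hlam : 0 ≤ lam) {c : Fin p → ℝ} (hc : ∀ i, 0 ≤ c i)
    {Ω : Set (Fin p → ℝ)} (hΩ : Convex ℝ Ω) :
    ConvexOn ℝ Ω fun x => f (A.mulVec x - b) + μ / 2 * (∑ i, (x i) ^ 2) +
      lam * (∑ i, c i * |x i|) := by
  refine ⟨hΩ, fun x _ y _ s t hs ht hst => ?_⟩
  have hfc : f (A.mulVec (s • x + t • y) - b) ≤
      s * f (A.mulVec x - b) + t * f (A.mulVec y - b) := by
    have h := hf.2 (Set.mem_univ (A.mulVec x - b)) (Set.mem_univ (A.mulVec y - b)) hs ht hst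
    have e : A.mulVec (s • x + t • y) - b =
        s • (A.mulVec x - b) + t • (A.mulVec y - b) := by
      rw [Matrix.mulVec_add, Matrix.mulVec_smul, Matrix.mulVec_smul]
      nth_rewrite 1 [← one_smul ℝ b]
      rw [← hst]
      module
    rw [e]
    simpa only [smul_eq_mul] using h
  have hsq : ∑ i, ((s • x + t • y) i) ^ 2 ≤ s * ∑ i, (x i) ^ 2 + t * ∑ i, (y i) ^ 2 := by
    rw [Finset.mul_sum, Finset.mul_sum, ← Finset.sum_add_distrib]
    refine Finset.sum_le_sum fun i _ => ?_
    have h := (even_two.convexOn_pow (𝕜 := ℝ)).2 (Set.mem_univ (x i)) (Set.mem_univ (y i))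
      hs ht hst
    simpa using h
  have habs : ∑ i, c i * |(s • x + t • y) i| ≤
      s * ∑ i, c i * |x i| + t * ∑ i, c i * |y i| := by
    rw [Finset.mul_sum, Finset.mul_sum, ← Finset.sum_add_distrib]
    refine Finset.sum_le_sum fun i _ => ?_
    have h : |s * x i + t * y i| ≤ s * |x i| + t * |y i| := by
      simpa only [abs_mul, abs_of_nonneg hs, abs_of_nonneg ht] using abs_add_le (s * x i) (t * y i)
    have h' := mul_le_mul_of_nonneg_left h (hc i)
    simp only [Pi.add_apply, Pi.smul_apply, smul_eq_mul]
    linarith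
  have hsq' := mul_le_mul_of_nonneg_left hsq (div_nonneg hμ zero_le_two)
  have habs' := mul_le_mul_of_nonneg_left habs hlam
  simp only [smul_eq_mul]
  linarith

/-- If `y` minimizes a convex function plus a 2-homogeneous proximal term centred at `x`, the
convex function decreases from `x` to `y` by at least twice the proximal term. -/
theorem ConvexOn.add_two_mul_prox_le {E : Type*} [AddCommGroup E] [Module ℝ E] {Ω : Set E}
    {F Q : E → ℝ} (hF : ConvexOn ℝ Ω F) (hQ : ∀ (r : ℝ) (z : E), Q (r • z) = r ^ 2 * Q z)
    {x y : E} (hx : x ∈ Ω) (hy : y ∈ Ω) (hmin : ∀ z ∈ Ω, F y + Q (y - x) ≤ F z + Q (z - x)) :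
    F y + 2 * Q (y - x) ≤ F x := by
  have key : ∀ t ∈ Set.Ioo (0 : ℝ) 1, F y + (2 - t) * Q (y - x) ≤ F x := by
    rintro t ⟨ht0, ht1⟩
    have hz := hmin _ (hF.1 hy hx (sub_nonneg.2 ht1.le) ht0.le (sub_add_cancel 1 t))
    have hc := hF.2 hy hx (sub_nonneg.2 ht1.le) ht0.le (sub_add_cancel 1 t)
    have e : (1 - t) • y + t • x - x = (1 - t) • (y - x) := by module
    rw [e, hQ] at hz
    simp only [smul_eq_mul] at hc
    refine le_of_mul_le_mul_left ?_ ht0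
    linarith
  have hlim : Filter.Tendsto (fun t : ℝ => F y + (2 - t) * Q (y - x))
      (nhdsWithin 0 (Set.Ioi 0)) (nhds (F y + (2 - 0) * Q (y - x))) :=
    (Continuous.tendsto (by fun_prop) 0).mono_left nhdsWithin_le_nhds
  rw [sub_zero] at hlim
  exact le_of_tendsto hlim
    (Filter.mem_of_superset (Ioo_mem_nhdsGT zero_lt_one) key)

/-- sufficient decrease of Θ_{λ,ρ} along one proximal MM step. -/
theorem stmt10 {n p : ℕ} (a ρ lam μ γ₁ γ₂ : ℝ)
    (ha : 1 < a) (hρ : 0 < ρ) (hlam : 0 < lam) (hμ : 0 < μ)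
    (hγ₁ : 0 < γ₁) (hγ₂ : 0 < γ₂)
    (f : (Fin n → ℝ) → ℝ) (hf : ConvexOn ℝ Set.univ f)
    (Ω : Set (Fin p → ℝ)) (hΩne : Ω.Nonempty) (hΩcl : IsClosed Ω)
    (hΩconv : Convex ℝ Ω)
    (A : Matrix (Fin n) (Fin p) ℝ) (b : Fin n → ℝ)
    (xk xk1 : Fin p → ℝ) (hxk : xk ∈ Ω) (hxk1 : xk1 ∈ Ω)
    (hmin : ∀ x ∈ Ω,
      f (A.mulVec xk1 - b) + μ / 2 * (∑ i, (xk1 i) ^ 2) +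
        lam * (∑ i, (1 - wRho a ρ xk i) * |xk1 i|) +
        γ₁ / 2 * (∑ i, (xk1 i - xk i) ^ 2) +
        γ₂ / 2 * (∑ i, (A.mulVec (xk1 - xk) i) ^ 2) ≤
      f (A.mulVec x - b) + μ / 2 * (∑ i, (x i) ^ 2) +
        lam * (∑ i, (1 - wRho a ρ xk i) * |x i|) +
        γ₁ / 2 * (∑ i, (x i - xk i) ^ 2) +
        γ₂ / 2 * (∑ i, (A.mulVec (x - xk) i) ^ 2)) :
    Theta f A b μ lam a ρ xk1 + γ₁ * (∑ i, (xk1 i - xk i) ^ 2) +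
        γ₂ * (∑ i, (A.mulVec (xk1 - xk) i) ^ 2) ≤
      Theta f A b μ lam a ρ xk := by
  have hF := convexOn_weighted_objective hf A b hμ.le hlam.le
    (fun i => sub_nonneg.2 (wRho_le_one a ρ xk i)) hΩconv
  have hdec := hF.add_two_mul_prox_le
    (Q := fun z => γ₁ / 2 * (∑ i, (z i) ^ 2) + γ₂ / 2 * (∑ i, (A.mulVec z i) ^ 2))
    (fun r z => by
      simp only [Matrix.mulVec_smul, Pi.smul_apply, smul_eq_mul, mul_pow, ← Finset.mul_sum]
      ring)
    hxk hxk1 (fun z hz => by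
      simpa only [Pi.sub_apply, add_assoc] using hmin z hz)
  simp only [Pi.sub_apply] at hdec
  have hψ : ∑ i, wRho a ρ xk i * (|xk1 i| - |xk i|) ≤
      ρ⁻¹ * ∑ i, psiStar a (ρ * |xk1 i|) - ρ⁻¹ * ∑ i, psiStar a (ρ * |xk i|) := by
    rw [Finset.mul_sum, Finset.mul_sum, ← Finset.sum_sub_distrib]
    exact Finset.sum_le_sum fun i _ => wRho_mul_sub_le ha hρ xk xk1 i
  have hψ' := mul_le_mul_of_nonneg_left hψ hlam.le
  simp only [mul_sub, sub_mul, one_mul, Finset.sum_sub_distrib] at hdec hψ'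
  unfold Theta
  linarith
end
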